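/- Let G be an ℓ-local subgroup of S_n and let μ₀ be the uniform probability measure on G. Then for all probability measures ν₁, ν₂ on G, T⌢₂(ν₂|ν₁) ≤ 2 c² · ( √H(ν₁|μ₀) + √H(ν₂|μ₀) )², where c² = 2(ℓ−1)² + 2. -/

import Mathlib

attribute [local instance] Classical.propDecidable

noncomputable section

/-- Degree (cardinality of the support) of a permutation. -/
noncomputable def degree {n : ℕ} (σ : Equiv.Perm (Fin n)) : ℕ :=
  (Finset.univ.filter fun i => σ i ≠ i).card

/-- `G` is an `ℓ`-local group of permutations. -/
def IsLLocal {n : ℕ} (ℓ : ℕ) (G : Subgroup (Equiv.Perm (Fin n))) : Prop :=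
  ∀ σ ∈ G, ∀ i j : Fin n, σ i = j →
    ∃ τ ∈ G, {x | τ x ≠ x} ⊆ {x | σ x ≠ x} ∧ degree τ ≤ ℓ ∧ τ i = j

/-- The uniform probability measure on `G`. -/
noncomputable def unif {n : ℕ} (G : Subgroup (Equiv.Perm (Fin n))) :
    Equiv.Perm (Fin n) → ℝ :=
  fun σ => if σ ∈ G then (Nat.card G : ℝ)⁻¹ else 0

/-- Relative entropy `H(ν | μ)` of finitely supported densities; `+∞` if `ν` is not
absolutely continuous with respect to `μ`. -/
noncomputable def relEnt {X : Type*} [Fintype X] (ν μ : X → ℝ) : ENNReal :=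
  if ∀ x, μ x = 0 → ν x = 0 then
    ENNReal.ofReal (∑ x, ν x * Real.log (ν x / μ x))
  else ⊤

/-- `p` is a probability measure supported on the set `S`. -/
def IsProbOn {X : Type*} [Fintype X] (p : X → ℝ) (S : Set X) : Prop :=
  (∀ x, 0 ≤ p x) ∧ (∀ x, x ∉ S → p x = 0) ∧ ∑ x, p x = 1

/-- The weak transport cost `T⌒₂(ν₂ | ν₁)` on a group of permutations
(kernel formulation, `π(σ, τ) = ν₁(σ) p_σ(τ)`). -/
noncomputable def parenT2 {n : ℕ} (ν₁ ν₂ : Equiv.Perm (Fin n) → ℝ) : ℝ :=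
  sInf {w | ∃ p : Equiv.Perm (Fin n) → Equiv.Perm (Fin n) → ℝ,
    (∀ σ τ, 0 ≤ p σ τ) ∧ (∀ σ, ∑ τ, p σ τ = 1) ∧ (∀ τ, ∑ σ, ν₁ σ * p σ τ = ν₂ τ) ∧
    w = ∑ σ, ν₁ σ * ∑ i : Fin n,
      (∑ τ, p σ τ * (if σ i ≠ τ i then (1 : ℝ) else 0)) ^ 2}

/-- The entropy functional `∑ ν log ν` of a finitely supported density. -/
def sumMulLog {X : Type*} [Fintype X] (ν : X → ℝ) : ℝ := ∑ x, ν x * Real.log (ν x)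

/-- `p` is a Markov kernel transporting `ν₁` onto `ν₂`. -/
def IsPlan {X : Type*} [Fintype X] (p : X → X → ℝ) (ν₁ ν₂ : X → ℝ) : Prop :=
  (∀ x y, 0 ≤ p x y) ∧ (∀ x, ∑ y, p x y = 1) ∧ ∀ y, ∑ x, ν₁ x * p x y = ν₂ y

lemma sq_add_le_of_conjugate {u v : ℝ} (hu : 1 < u) (huv : u + v = u * v) (x y : ℝ) :
    (x + y) ^ 2 ≤ u * x ^ 2 + v * y ^ 2 := by
  have h : 0 ≤ (u - 1) * (u * x ^ 2 + v * y ^ 2 - (x + y) ^ 2) := by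
    have : (u - 1) * (u * x ^ 2 + v * y ^ 2 - (x + y) ^ 2) = ((u - 1) * x - y) ^ 2 := by
      linear_combination (-y ^ 2) * huv
    rw [this]; positivity
  have := nonneg_of_mul_nonneg_right h (by linarith)
  linarith

lemma sq_sub_one_div_le {a : ℝ} (ha : 1 ≤ a) :
    (a - 1) ^ 2 / a ≤ 2 * (a * Real.log a - a + 1) := by
  have h := Real.le_log_one_add_of_nonneg (x := a - 1) (by linarith)
  rw [show a - 1 + 2 = a + 1 by ring, show 1 + (a - 1) = a by ring] at h
  have h2 : a * (2 * (a - 1) / (a + 1)) ≤ a * Real.log a :=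
    mul_le_mul_of_nonneg_left h (by linarith)
  have h3 : (a - 1) ^ 2 / a ≤ 2 * (a * (2 * (a - 1) / (a + 1)) - a + 1) := by
    have : 2 * (a * (2 * (a - 1) / (a + 1)) - a + 1) = 2 * (a - 1) ^ 2 / (a + 1) := by
      field_simp
      ring
    rw [this, div_le_div_iff₀ (by linarith) (by linarith)]
    nlinarith [mul_nonneg (sq_nonneg (a - 1)) (sub_nonneg.2 ha)]
  linarith

lemma one_sub_sq_le {b : ℝ} (hb : 0 ≤ b) (hb1 : b ≤ 1) :
    (1 - b) ^ 2 ≤ 2 * (b * Real.log b - b + 1) := by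
  rcases hb.eq_or_lt with rfl | hb
  · norm_num
  have h : Real.sinh (Real.log b) ≤ Real.log b :=
    Real.sinh_le_self_iff.2 (Real.log_nonpos hb.le hb1)
  rw [Real.sinh_log hb] at h
  have h2 := mul_le_mul_of_nonneg_left h hb.le
  have h3 : b * ((b - b⁻¹) / 2) = (b ^ 2 - 1) / 2 := by field_simp
  nlinarith

lemma mul_log_sub_add_one_nonneg {b : ℝ} (hb : 0 ≤ b) : 0 ≤ b * Real.log b - b + 1 := by
  rcases le_total b 1 with h | h
  · nlinarith [one_sub_sq_le hb h, sq_nonneg (1 - b)]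
  · have := sq_sub_one_div_le h
    have : 0 ≤ (b - 1) ^ 2 / b := by positivity
    linarith

lemma sq_sub_div_le {u v a b : ℝ} (hu : 1 < u) (hv : 1 < v) (huv : u + v = u * v)
    (ha : 0 < a) (hb : 0 ≤ b) (hba : b ≤ a) :
    (a - b) ^ 2 / a ≤
      2 * (u * (a * Real.log a - a + 1) + v * (b * Real.log b - b + 1)) := by
  have hA := mul_log_sub_add_one_nonneg ha.le
  have hB := mul_log_sub_add_one_nonneg hb
  rcases le_total 1 a with h1 | h1
  · have h2 := sq_sub_one_div_le h1
    rcases le_total b 1 with h3 | h3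
    · have h4 := one_sub_sq_le hb h3
      have h5 : (1 - b) ^ 2 / a ≤ (1 - b) ^ 2 := div_le_self (sq_nonneg _) h1
      have h6 : (a - b) ^ 2 / a ≤ u * ((a - 1) ^ 2 / a) + v * ((1 - b) ^ 2 / a) := by
        rw [← mul_div_assoc, ← mul_div_assoc, ← add_div]
        gcongr
        have := sq_add_le_of_conjugate hu huv (a - 1) (1 - b)
        rwa [show a - 1 + (1 - b) = a - b by ring] at this
      nlinarith
    · have h4 : (a - b) ^ 2 / a ≤ (a - 1) ^ 2 / a := by
        gcongr
      nlinarith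
  · have h2 := one_sub_sq_le hb (hba.trans h1)
    have h3 : (a - b) ^ 2 / a ≤ (1 - b) ^ 2 := by
      rw [div_le_iff₀ ha]
      have : b ^ 2 ≤ a := by nlinarith
      nlinarith [mul_nonneg (sub_nonneg.2 h1) (sub_nonneg.2 this)]
    nlinarith

lemma sum_mul_log_card {X : Type*} [Fintype X] {O : Finset X} {α : X → ℝ}
    (hO : O.Nonempty) (hα : IsProbOn α (O : Set X)) :
    ∑ i ∈ O, (O.card : ℝ)⁻¹ * ((O.card * α i) * Real.log (O.card * α i) - O.card * α i + 1) =
      sumMulLog α + Real.log O.card := by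
  have hM : (O.card : ℝ) ≠ 0 := by exact_mod_cast hO.card_pos.ne'
  have hsub : ∀ f : X → ℝ, (∀ x, α x = 0 → f x = 0) → ∑ x ∈ O, f x = ∑ x, f x := fun f hf =>
    Finset.sum_subset (Finset.subset_univ _) fun x _ hx => hf x (hα.2.1 x (by simpa using hx))
  have h : ∀ i ∈ O, (O.card : ℝ)⁻¹ *
      ((O.card * α i) * Real.log (O.card * α i) - O.card * α i + 1) =
      α i * Real.log (α i) + α i * Real.log O.card - α i + (O.card : ℝ)⁻¹ := by
    intro i _
    rcases eq_or_ne (α i) 0 with h0 | h0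
    · simp [h0]
    · rw [Real.log_mul hM h0]; field_simp; ring
  rw [Finset.sum_congr rfl h, Finset.sum_add_distrib, Finset.sum_sub_distrib,
    Finset.sum_add_distrib, ← Finset.sum_mul, hsub _ (fun x hx => by simp [hx]),
    hsub α (fun x hx => hx), hα.2.2, Finset.sum_const, nsmul_eq_mul, mul_inv_cancel₀ hM, sumMulLog]
  ring

lemma sumMulLog_add_log_card_nonneg {X : Type*} [Fintype X] {O : Finset X} {α : X → ℝ}
    (hα : IsProbOn α (O : Set X)) : 0 ≤ sumMulLog α + Real.log O.card := by
  have hO : O.Nonempty := by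
    by_contra h
    rw [Finset.not_nonempty_iff_eq_empty] at h
    have := hα.2.2
    rw [Finset.sum_eq_zero fun x _ => hα.2.1 x (by simp [h])] at this
    norm_num at this
  rw [← sum_mul_log_card hO hα]
  exact Finset.sum_nonneg fun i _ => mul_nonneg (by positivity)
    (mul_log_sub_add_one_nonneg (mul_nonneg (by positivity) (hα.1 i)))

lemma exists_plan_sq_diag_le {X : Type*} [Fintype X] {O : Finset X} {α β : X → ℝ} {u v : ℝ}
    (hu : 1 < u) (hv : 1 < v) (huv : u + v = u * v)
    (hα : IsProbOn α (O : Set X)) (hβ : IsProbOn β (O : Set X)) :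
    ∃ q, IsPlan q α β ∧ ∑ i, α i * (1 - q i i) ^ 2 ≤
      2 * (u * (sumMulLog α + Real.log O.card) + v * (sumMulLog β + Real.log O.card)) := by
  have hO : O.Nonempty := by
    by_contra h
    rw [Finset.not_nonempty_iff_eq_empty] at h
    have := hα.2.2
    rw [Finset.sum_eq_zero fun x _ => hα.2.1 x (by simp [h])] at this
    norm_num at this
  have hM : (0 : ℝ) < O.card := by exact_mod_cast hO.card_pos
  set θ : X → ℝ := fun i => min 1 (β i / α i) with hθ
  have hθ0 : ∀ i, 0 ≤ θ i := fun i => le_min zero_le_one (div_nonneg (hβ.1 i) (hα.1 i))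
  have hθ1 : ∀ i, θ i ≤ 1 := fun i => min_le_left _ _
  have hαθ : ∀ i, α i * θ i = min (α i) (β i) := by
    intro i
    rcases (hα.1 i).eq_or_lt with h0 | h0
    · simp [← h0, hβ.1 i]
    · rw [hθ]; simp only
      rw [mul_min_of_nonneg _ _ h0.le, mul_one, mul_div_cancel₀ _ h0.ne']
  have hplan : ∃ q, IsPlan q α β ∧ ∀ i, θ i ≤ q i i := by
    set D : ℝ := ∑ i, (β i - min (α i) (β i)) with hD
    have hr : ∀ i, 0 ≤ β i - min (α i) (β i) := fun i => sub_nonneg.2 (min_le_right _ _)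
    have hD' : ∑ i, (α i - min (α i) (β i)) = D := by
      rw [hD, Finset.sum_sub_distrib, Finset.sum_sub_distrib, hα.2.2, hβ.2.2]
    have hD0 : 0 ≤ D := Finset.sum_nonneg fun i _ => hr i
    rcases hD0.eq_or_lt with h0 | h0
    · have h1 : ∀ i, β i - min (α i) (β i) = 0 := fun i =>
        (Finset.sum_eq_zero_iff_of_nonneg fun i _ => hr i).1 h0.symm i (Finset.mem_univ i)
      have h2 : ∀ i, α i - min (α i) (β i) = 0 := fun i =>
        (Finset.sum_eq_zero_iff_of_nonneg fun i _ => sub_nonneg.2 (min_le_left _ _)).1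
          (hD'.trans h0.symm) i (Finset.mem_univ i)
      refine ⟨fun i j => if i = j then 1 else 0, ⟨fun i j => ?_, fun i => ?_, fun j => ?_⟩,
        fun i => ?_⟩
      · dsimp only
        split_ifs <;> norm_num
      · simp
      · simp only [mul_ite, mul_one, mul_zero, Finset.sum_ite_eq', Finset.mem_univ, if_true]
        linarith [h1 j, h2 j]
      · simpa using hθ1 i
    · refine ⟨fun i j => (if i = j then θ i else 0) +
        (1 - θ i) * ((β j - min (α j) (β j)) / D), ⟨fun i j => ?_, fun i => ?_, fun j => ?_⟩,
        fun i => ?_⟩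
      · have := mul_nonneg (sub_nonneg.2 (hθ1 i)) (div_nonneg (hr j) h0.le)
        dsimp only
        split_ifs
        · linarith [hθ0 i]
        · linarith
      · rw [Finset.sum_add_distrib, ← Finset.mul_sum, ← Finset.sum_div, ← hD, div_self h0.ne']
        simp
      · simp only [mul_add, Finset.sum_add_distrib, mul_ite, mul_zero, Finset.sum_ite_eq',
          Finset.mem_univ, if_true, ← mul_assoc, ← Finset.sum_mul, mul_sub, mul_one, hαθ, hD']
        field_simp
        ring
      · simpa using mul_nonneg (sub_nonneg.2 (hθ1 i)) (div_nonneg (hr i) h0.le)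
  obtain ⟨q, hq, hqθ⟩ := hplan
  refine ⟨q, hq, ?_⟩
  have hpt : ∀ i ∈ O, α i * (1 - q i i) ^ 2 ≤
      2 * (u * ((O.card : ℝ)⁻¹ *
        ((O.card * α i) * Real.log (O.card * α i) - O.card * α i + 1)) +
      v * ((O.card : ℝ)⁻¹ *
        ((O.card * β i) * Real.log (O.card * β i) - O.card * β i + 1))) := by
    intro i _
    have hqi : q i i ≤ 1 := by
      rw [← hq.2.1 i]
      exact Finset.single_le_sum (f := q i) (fun j _ => hq.1 i j) (Finset.mem_univ i)
    have hA := mul_log_sub_add_one_nonneg (mul_nonneg hM.le (hα.1 i))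
    have hB := mul_log_sub_add_one_nonneg (mul_nonneg hM.le (hβ.1 i))
    have hMi : (0 : ℝ) < (O.card : ℝ)⁻¹ := by positivity
    have h1 : α i * (1 - q i i) ^ 2 ≤ α i * (1 - θ i) ^ 2 := by
      have := hα.1 i
      have := hqθ i
      gcongr
    refine h1.trans ?_
    by_cases hc : 0 < α i ∧ β i ≤ α i
    · obtain ⟨h0, hba⟩ := hc
      have hkey := sq_sub_div_le hu hv huv (mul_pos hM h0) (mul_nonneg hM.le (hβ.1 i))
        (mul_le_mul_of_nonneg_left hba hM.le)
      have hθi : θ i = β i / α i := min_eq_right ((div_le_one h0).2 hba)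
      have : α i * (1 - θ i) ^ 2 = (O.card : ℝ)⁻¹ *
          ((O.card * α i - O.card * β i) ^ 2 / (O.card * α i)) := by
        rw [hθi]; field_simp
      rw [this]
      calc _ ≤ (O.card : ℝ)⁻¹ * _ := mul_le_mul_of_nonneg_left hkey hMi.le
        _ = _ := by ring
    · have : α i * (1 - θ i) ^ 2 = 0 := by
        rcases (hα.1 i).eq_or_lt with h0 | h0
        · simp [← h0]
        · have : α i ≤ β i := by
            by_contra h
            exact hc ⟨h0, (not_le.1 h).le⟩
          have : θ i = 1 := min_eq_left ((one_le_div h0).2 this)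
          simp [this]
      rw [this]
      positivity
  rw [← sum_mul_log_card hO hα, ← sum_mul_log_card hO hβ, Finset.mul_sum, Finset.mul_sum,
    ← Finset.sum_add_distrib, Finset.mul_sum]
  rw [← Finset.sum_subset (Finset.subset_univ O) fun x _ hx => by
    rw [hα.2.1 x (by simpa using hx), zero_mul]]
  exact Finset.sum_le_sum hpt

section Disintegration

variable {X ι : Type*} [Fintype X]

/-- The image of the density `ν` under `f`. -/
def pushDensity (ν : X → ℝ) (f : X → ι) (i : ι) : ℝ := ∑ x, if f x = i then ν x else 0

/-- The density `ν` conditioned on the fibre `f = i`. -/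
def condDensity (ν : X → ℝ) (f : X → ι) (i : ι) (x : X) : ℝ :=
  if f x = i then ν x / pushDensity ν f i else 0

variable {ν : X → ℝ}

lemma pushDensity_nonneg (hν : ∀ x, 0 ≤ ν x) (f : X → ι) (i : ι) : 0 ≤ pushDensity ν f i :=
  Finset.sum_nonneg fun x _ => by split_ifs <;> simp [hν]

lemma le_pushDensity (hν : ∀ x, 0 ≤ ν x) (f : X → ι) (x : X) : ν x ≤ pushDensity ν f (f x) := by
  have := Finset.single_le_sum (f := fun y => if f y = f x then ν y else 0)
    (fun y _ => by split_ifs <;> simp [hν]) (Finset.mem_univ x)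
  simpa [pushDensity] using this

lemma pushDensity_mul_condDensity (hν : ∀ x, 0 ≤ ν x) (f : X → ι) (i : ι) (x : X) :
    pushDensity ν f i * condDensity ν f i x = if f x = i then ν x else 0 := by
  unfold condDensity
  split_ifs with h
  · rcases eq_or_ne (pushDensity ν f i) 0 with h0 | h0
    · have := le_pushDensity hν f x
      rw [h, h0] at this
      rw [h0, zero_mul, le_antisymm this (hν x)]
    · rw [mul_div_cancel₀ _ h0]
  · simp

lemma condDensity_nonneg (hν : ∀ x, 0 ≤ ν x) (f : X → ι) (i : ι) (x : X) : 0 ≤ condDensity ν f i x := by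
  unfold condDensity
  split_ifs
  · exact div_nonneg (hν x) (pushDensity_nonneg hν f i)
  · exact le_rfl

lemma sum_mul_eq_sum_pushDensity [Fintype ι] (hν : ∀ x, 0 ≤ ν x) (f : X → ι)
    (F : ι → X → ℝ) :
    ∑ x, ν x * F (f x) x = ∑ i, pushDensity ν f i * ∑ x, condDensity ν f i x * F i x := by
  simp only [Finset.mul_sum, ← mul_assoc, pushDensity_mul_condDensity hν]
  rw [Finset.sum_comm]
  refine Finset.sum_congr rfl fun x _ => ?_
  simp

lemma sum_condDensity (hν : ∀ x, 0 ≤ ν x) (f : X → ι) {i : ι}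
    (hi : 0 < pushDensity ν f i) : ∑ x, condDensity ν f i x = 1 := by
  have : pushDensity ν f i * ∑ x, condDensity ν f i x = pushDensity ν f i := by
    rw [Finset.mul_sum]
    simp only [pushDensity_mul_condDensity hν]
    rfl
  exact mul_left_cancel₀ hi.ne' (by rw [this, mul_one])

lemma isProbOn_pushDensity [Fintype ι] (f : X → ι) {S : Set X} {T : Set ι}
    (h : IsProbOn ν S) (hf : ∀ x ∈ S, f x ∈ T) :
    IsProbOn (pushDensity ν f) T := by
  refine ⟨pushDensity_nonneg h.1 f, fun i hi => Finset.sum_eq_zero fun x _ => ?_, ?_⟩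
  · split_ifs with hx
    · exact h.2.1 x fun hxS => hi (hx ▸ hf x hxS)
    · rfl
  · unfold pushDensity
    rw [Finset.sum_comm]
    simpa using h.2.2

lemma exists_of_pushDensity_pos (f : X → ι) {S : Set X} (h : IsProbOn ν S) {i : ι}
    (hi : 0 < pushDensity ν f i) : ∃ x ∈ S, f x = i := by
  by_contra! hne
  refine hi.ne' (Finset.sum_eq_zero fun x _ => ?_)
  split_ifs with hx
  · exact h.2.1 x fun hxS => hne x hxS hx
  · rfl

lemma isProbOn_condDensity (f : X → ι) {S : Set X} (h : IsProbOn ν S) {i : ι}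
    (hi : 0 < pushDensity ν f i) :
    IsProbOn (condDensity ν f i) {x | x ∈ S ∧ f x = i} := by
  refine ⟨condDensity_nonneg h.1 f i, fun x hx => ?_, sum_condDensity h.1 f hi⟩
  unfold condDensity
  split_ifs with hxi
  · rw [h.2.1 x fun hxS => hx ⟨hxS, hxi⟩, zero_div]
  · rfl

lemma sumMulLog_eq_add_sum [Fintype ι] (hν : ∀ x, 0 ≤ ν x) (f : X → ι) :
    sumMulLog ν = sumMulLog (pushDensity ν f) +
      ∑ i, pushDensity ν f i * sumMulLog (condDensity ν f i) := by
  have h : ∀ x, ν x * Real.log (ν x) =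
      ν x * (Real.log (pushDensity ν f (f x)) + Real.log (condDensity ν f (f x) x)) := by
    intro x
    rcases (hν x).eq_or_lt with h0 | h0
    · simp [← h0]
    have h1 := h0.trans_le (le_pushDensity hν f x)
    rw [condDensity, if_pos rfl, Real.log_div h0.ne' h1.ne']
    ring
  unfold sumMulLog
  rw [Finset.sum_congr rfl fun x _ => h x, sum_mul_eq_sum_pushDensity hν f fun i x =>
    Real.log (pushDensity ν f i) + Real.log (condDensity ν f i x), ← Finset.sum_add_distrib]
  refine Finset.sum_congr rfl fun i _ => ?_
  simp only [mul_add, Finset.sum_add_distrib, ← Finset.sum_mul]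
  rcases (pushDensity_nonneg hν f i).eq_or_lt with h0 | h0
  · simp [← h0]
  · rw [sum_condDensity hν f h0, one_mul]

end Disintegration

lemma IsPlan.eq_zero_of_eq_zero {X : Type*} [Fintype X] {p : X → X → ℝ} {ν₁ ν₂ : X → ℝ}
    (hp : IsPlan p ν₁ ν₂) (hν : ∀ x, 0 ≤ ν₁ x) {x y : X} (hx : 0 < ν₁ x) (hy : ν₂ y = 0) :
    p x y = 0 := by
  have h := (Finset.sum_eq_zero_iff_of_nonneg fun z _ => mul_nonneg (hν z) (hp.1 z y)).1
    ((hp.2.2 y).trans hy) x (Finset.mem_univ x)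
  exact (mul_eq_zero.1 h).resolve_left hx.ne'

lemma exists_isPlan_self {X : Type*} [Fintype X] (ν : X → ℝ) :
    ∃ p, IsPlan p ν ν ∧ ∀ x y, x ≠ y → p x y = 0 := by
  classical
  refine ⟨fun x y => if x = y then 1 else 0, ⟨fun x y => ?_, fun x => ?_, fun y => ?_⟩,
    fun x y h => if_neg h⟩
  · dsimp only
    split_ifs <;> norm_num
  · simp
  · simp

/-- The probability that a random permutation with density `p` disagrees with `ρ` at `k`. -/
def mismatch {n : ℕ} (p : Equiv.Perm (Fin n) → ℝ) (ρ : Equiv.Perm (Fin n)) (k : Fin n) : ℝ :=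
  ∑ τ, p τ * (if ρ k ≠ τ k then (1 : ℝ) else 0)

/-- There is a plan from `ν₁` to `ν₂` whose shifted cost exceeds `C` by at most twice the square
of the total shift. -/
def HasShiftedPlan {n : ℕ} (ν₁ ν₂ : Equiv.Perm (Fin n) → ℝ) (b : Fin n → ℝ) (C : ℝ) : Prop :=
  ∃ p, IsPlan p ν₁ ν₂ ∧
    ∑ σ, ν₁ σ * ∑ k, (mismatch (p σ) σ k + b k) ^ 2 ≤ 2 * (∑ k, b k) ^ 2 + C

/-- The entropic upper bound relative to the uniform measure on `G`. -/
def entropyBound {n : ℕ} (c u v : ℝ) (G : Subgroup (Equiv.Perm (Fin n)))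
    (ν₁ ν₂ : Equiv.Perm (Fin n) → ℝ) : ℝ :=
  2 * c * (u * (sumMulLog ν₁ + Real.log (Nat.card G)) + v * (sumMulLog ν₂ + Real.log (Nat.card G)))

/-- The transport-entropy inequality on `G`, with arbitrary nonnegative shifts. -/
def ShiftedTransport {n : ℕ} (c u v : ℝ) (G : Subgroup (Equiv.Perm (Fin n))) : Prop :=
  ∀ ν₁ ν₂, IsProbOn ν₁ (G : Set (Equiv.Perm (Fin n))) →
    IsProbOn ν₂ (G : Set (Equiv.Perm (Fin n))) → ∀ b : Fin n → ℝ, (∀ k, 0 ≤ b k) →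
      HasShiftedPlan ν₁ ν₂ b (entropyBound c u v G ν₁ ν₂)

lemma sumMulLog_comp_equiv {X : Type*} [Fintype X] (ν : X → ℝ) (e : X ≃ X) :
    sumMulLog (fun x => ν (e x)) = sumMulLog ν :=
  Equiv.sum_comp e fun x => ν x * Real.log (ν x)

lemma hasShiftedPlan_of_single {n : ℕ} {ν₁ ν₂ : Equiv.Perm (Fin n) → ℝ} {C : ℝ}
    (hn : 0 < n) (hν : ∀ σ, 0 ≤ ν₁ σ)
    (h : ∀ a B, 0 ≤ B → HasShiftedPlan ν₁ ν₂ (Pi.single a B) C)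
    {b : Fin n → ℝ} (hb : ∀ k, 0 ≤ b k) : HasShiftedPlan ν₁ ν₂ b C := by
  set B := ∑ k, b k with hB
  have hB0 : 0 ≤ B := Finset.sum_nonneg fun k _ => hb k
  rcases hB0.eq_or_lt with h0 | h0
  · have : b = Pi.single ⟨0, hn⟩ 0 := by
      ext k
      rw [Pi.single_zero]
      exact (Finset.sum_eq_zero_iff_of_nonneg fun k _ => hb k).1 (hB.symm.trans h0.symm) k
        (Finset.mem_univ k)
    rw [this]
    exact h _ _ le_rfl
  choose P hP hPc using fun a => h a B hB0
  have hw0 : ∀ a, 0 ≤ b a / B := fun a => div_nonneg (hb a) hB0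
  have hw1 : ∑ a, b a / B = 1 := by rw [← Finset.sum_div, ← hB, div_self h0.ne']
  refine ⟨fun σ τ => ∑ a, b a / B * P a σ τ, ⟨fun σ τ => ?_, fun σ => ?_, fun τ => ?_⟩, ?_⟩
  · exact Finset.sum_nonneg fun a _ => mul_nonneg (hw0 a) ((hP a).1 σ τ)
  · rw [Finset.sum_comm]
    simp only [← Finset.mul_sum, (hP _).2.1, mul_one, hw1]
  · simp only [Finset.mul_sum]
    rw [Finset.sum_comm]
    calc _ = ∑ a, b a / B * ∑ σ, ν₁ σ * P a σ τ := by
          refine Finset.sum_congr rfl fun a _ => ?_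
          rw [Finset.mul_sum]
          exact Finset.sum_congr rfl fun σ _ => by ring
      _ = _ := by simp only [(hP _).2.2, ← Finset.sum_mul, hw1, one_mul]
  · have hm : ∀ σ k, mismatch (fun τ => ∑ a, b a / B * P a σ τ) σ k + b k =
        ∑ a, b a / B * (mismatch (P a σ) σ k + Pi.single (M := fun _ => ℝ) a B k) := by
      intro σ k
      simp only [mul_add, Finset.sum_add_distrib]
      congr 1
      · simp only [mismatch, Finset.mul_sum, Finset.sum_mul]
        rw [Finset.sum_comm]
        exact Finset.sum_congr rfl fun a _ => Finset.sum_congr rfl fun τ _ => by ring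
      · simp only [Pi.single_apply, mul_ite, mul_zero, Finset.sum_ite_eq, Finset.mem_univ, if_true]
        field_simp
    calc _ ≤ ∑ σ, ν₁ σ * ∑ k, ∑ a, b a / B *
          (mismatch (P a σ) σ k + Pi.single (M := fun _ => ℝ) a B k) ^ 2 := by
          refine Finset.sum_le_sum fun σ _ => mul_le_mul_of_nonneg_left
            (Finset.sum_le_sum fun k _ => ?_) (hν σ)
          rw [hm]
          exact Real.pow_arith_mean_le_arith_mean_pow_of_even _ _ _ (fun a _ => hw0 a) hw1
            even_two
      _ = ∑ a, b a / B * ∑ σ, ν₁ σ * ∑ k,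
          (mismatch (P a σ) σ k + Pi.single (M := fun _ => ℝ) a B k) ^ 2 := by
          simp only [Finset.mul_sum]
          rw [Finset.sum_comm (s := Finset.univ (α := Fin n))]
          refine Finset.sum_congr rfl fun σ _ => ?_
          rw [Finset.sum_comm]
          exact Finset.sum_congr rfl fun a _ => Finset.sum_congr rfl fun k _ => by ring
      _ ≤ ∑ a, b a / B * (2 * B ^ 2 + C) := by
          refine Finset.sum_le_sum fun a _ => mul_le_mul_of_nonneg_left ?_ (hw0 a)
          simpa using hPc a
      _ = _ := by rw [← Finset.sum_mul, hw1, one_mul]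

lemma ShiftedTransport.exists_plan_coset {n : ℕ} {c u v : ℝ} {K : Subgroup (Equiv.Perm (Fin n))}
    (hK : ShiftedTransport c u v K) {ν₁ ν₂ : Equiv.Perm (Fin n) → ℝ} {g t : Equiv.Perm (Fin n)}
    (h₁ : IsProbOn ν₁ {σ | g⁻¹ * σ ∈ K}) (h₂ : IsProbOn ν₂ {τ | (t * g)⁻¹ * τ ∈ K})
    {b : Fin n → ℝ} (hb : ∀ k, 0 ≤ b k) :
    ∃ p, IsPlan p ν₁ ν₂ ∧
      ∑ σ, ν₁ σ * ∑ k, (mismatch (p σ) (t * σ) k + b (σ k)) ^ 2 ≤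
        2 * (∑ k, b k) ^ 2 + entropyBound c u v K ν₁ ν₂ := by
  let e : Equiv.Perm (Fin n) → Equiv.Perm (Fin n) ≃ Equiv.Perm (Fin n) := fun h =>
    (Equiv.inv _).trans (Equiv.mulLeft h)
  have he : ∀ h ρ, e h ρ = h * ρ⁻¹ := fun _ _ => rfl
  have hprob : ∀ (h : Equiv.Perm (Fin n)) (ν : Equiv.Perm (Fin n) → ℝ),
      IsProbOn ν {σ | h⁻¹ * σ ∈ K} → IsProbOn (fun ρ => ν (e h ρ)) (K : Set _) := by
    refine fun h ν H => ⟨fun ρ => H.1 _, fun ρ hρ => H.2.1 _ ?_, ?_⟩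
    · simpa [he] using hρ
    · rw [Equiv.sum_comp (e h) ν]
      exact H.2.2
  obtain ⟨p, hp, hpc⟩ := hK _ _ (hprob g ν₁ h₁) (hprob (t * g) ν₂ h₂) (fun k => b (g k))
    (fun k => hb _)
  refine ⟨fun σ τ => p ((e g).symm σ) ((e (t * g)).symm τ), ⟨fun σ τ => hp.1 _ _, fun σ => ?_,
    fun τ => ?_⟩, ?_⟩
  · rw [Equiv.sum_comp (e (t * g)).symm (p ((e g).symm σ))]
    exact hp.2.1 _
  · rw [← Equiv.sum_comp (e g)]
    simpa using hp.2.2 ((e (t * g)).symm τ)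
  · rw [← Equiv.sum_comp (e g)]
    simp only [Equiv.symm_apply_apply]
    rw [Equiv.sum_comp g b, entropyBound, sumMulLog_comp_equiv ν₁ (e g),
      sumMulLog_comp_equiv ν₂ (e (t * g))] at hpc
    refine le_of_eq_of_le (Finset.sum_congr rfl fun ρ _ => ?_) hpc
    congr 1
    rw [← Equiv.sum_comp ρ]
    refine Finset.sum_congr rfl fun k _ => ?_
    have hm : mismatch (fun τ => p ρ ((e (t * g)).symm τ)) (t * (e g) ρ) (ρ k) =
        mismatch (p ρ) ρ k := by
      unfold mismatch
      rw [← Equiv.sum_comp (e (t * g))]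
      refine Finset.sum_congr rfl fun τ _ => ?_
      simp only [Equiv.symm_apply_apply]
      congr 1
      refine if_congr (not_congr ?_) rfl rfl
      simp only [he, Equiv.Perm.mul_apply, EmbeddingLike.apply_eq_iff_eq]
      rw [Equiv.Perm.eq_inv_iff_eq, eq_comm]
      simp
    rw [hm]
    simp [he]

/-- The elements of `G` fixing `a`. -/
def pointStabilizer {n : ℕ} (G : Subgroup (Equiv.Perm (Fin n))) (a : Fin n) :
    Subgroup (Equiv.Perm (Fin n)) :=
  (MulAction.stabilizer G a).map G.subtype

lemma mem_pointStabilizer {n : ℕ} {G : Subgroup (Equiv.Perm (Fin n))} {a : Fin n}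
    {σ : Equiv.Perm (Fin n)} : σ ∈ pointStabilizer G a ↔ σ ∈ G ∧ σ a = a := by
  simp only [pointStabilizer, Subgroup.mem_map, MulAction.mem_stabilizer_iff]
  constructor
  · rintro ⟨x, hx, rfl⟩
    exact ⟨x.2, hx⟩
  · rintro ⟨h1, h2⟩
    exact ⟨⟨σ, h1⟩, h2, rfl⟩

/-- The orbit of `a` under `G`. -/
def orbitFinset {n : ℕ} (G : Subgroup (Equiv.Perm (Fin n))) (a : Fin n) : Finset (Fin n) :=
  Finset.univ.filter fun i => ∃ σ ∈ G, σ a = i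

lemma log_card_eq_add {n : ℕ} (G : Subgroup (Equiv.Perm (Fin n))) (a : Fin n) :
    Real.log (Nat.card G) =
      Real.log (orbitFinset G a).card + Real.log (Nat.card (pointStabilizer G a)) := by
  have h1 : Nat.card (MulAction.orbit G a) = (orbitFinset G a).card := by
    rw [Nat.card_coe_set_eq, ← Set.ncard_coe_finset]
    congr 1
    ext i
    simp only [orbitFinset, MulAction.mem_orbit_iff, SetLike.mem_coe, Finset.mem_filter,
      Finset.mem_univ, true_and]
    exact ⟨fun ⟨x, hx⟩ => ⟨x, x.2, hx⟩, fun ⟨σ, hσ, h⟩ => ⟨⟨σ, hσ⟩, h⟩⟩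
  have h2 : Nat.card (pointStabilizer G a) = Nat.card (MulAction.stabilizer G a) :=
    Subgroup.card_map_of_injective G.subtype_injective
  have h3 : Nat.card G = (orbitFinset G a).card * Nat.card (pointStabilizer G a) := by
    rw [h2, ← h1, ← Nat.card_prod]
    exact Nat.card_congr (MulAction.orbitProdStabilizerEquivGroup G a).symm
  have h0 : Nat.card G ≠ 0 := Nat.card_pos.ne'
  rw [h3] at h0
  rw [h3, Nat.cast_mul, Real.log_mul (by exact_mod_cast left_ne_zero_of_mul h0)
    (by exact_mod_cast right_ne_zero_of_mul h0)]

lemma IsLLocal.pointStabilizer {n ℓ : ℕ} {G : Subgroup (Equiv.Perm (Fin n))}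
    (hG : IsLLocal ℓ G) (a : Fin n) : IsLLocal ℓ (pointStabilizer G a) := by
  intro σ hσ i j hij
  rw [mem_pointStabilizer] at hσ
  obtain ⟨τ, hτ, hsupp, hdeg, hτij⟩ := hG σ hσ.1 i j hij
  refine ⟨τ, mem_pointStabilizer.2 ⟨hτ, ?_⟩, hsupp, hdeg, hτij⟩
  by_contra h
  exact hsupp h hσ.2

lemma IsLLocal.exists_transfer {n ℓ : ℕ} {G : Subgroup (Equiv.Perm (Fin n))}
    (hG : IsLLocal ℓ G) :
    ∃ t : Fin n → Fin n → Equiv.Perm (Fin n), (∀ i, t i i = 1) ∧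
      ∀ i j, i ≠ j → (∃ σ ∈ G, σ i = j) → t i j ∈ G ∧ t i j i = j ∧ degree (t i j) ≤ ℓ := by
  have h : ∀ i j, ∃ t : Equiv.Perm (Fin n), (i = j → t = 1) ∧
      (i ≠ j → (∃ σ ∈ G, σ i = j) → t ∈ G ∧ t i = j ∧ degree t ≤ ℓ) := by
    intro i j
    by_cases hij : i ≠ j ∧ ∃ σ ∈ G, σ i = j
    · obtain ⟨h1, σ, hσ, hσij⟩ := hij
      obtain ⟨τ, hτ, -, hdeg, hτij⟩ := hG σ hσ i j hσij
      exact ⟨τ, fun h => absurd h h1, fun _ _ => ⟨hτ, hτij, hdeg⟩⟩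
    · exact ⟨1, fun _ => rfl, fun h1 h2 => absurd ⟨h1, h2⟩ hij⟩
  choose t ht ht' using h
  exact ⟨t, fun i => ht i i rfl, ht'⟩

lemma sum_moved_le {n ℓ : ℕ} {t : Equiv.Perm (Fin n)} {i : Fin n} (hi : t i ≠ i)
    (ht : degree t ≤ ℓ) :
    ∑ k, (if t k ≠ k ∧ k ≠ i then (1 : ℝ) else 0) ≤ (ℓ : ℝ) - 1 := by
  have h1 : (Finset.univ.filter fun k => t k ≠ k ∧ k ≠ i) =
      (Finset.univ.filter fun k => t k ≠ k).erase i := by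
    ext k
    simp [and_comm]
  have h2 : (Finset.univ.filter fun k => t k ≠ k ∧ k ≠ i).card + 1 ≤ ℓ := by
    rw [h1, Finset.card_erase_add_one (by simpa using hi)]
    exact ht
  rw [Finset.sum_boole]
  have : (((Finset.univ.filter fun k => t k ≠ k ∧ k ≠ i).card : ℝ)) + 1 ≤ ℓ := by
    exact_mod_cast h2
  linarith

lemma mismatch_nonneg {n : ℕ} {p : Equiv.Perm (Fin n) → ℝ} (hp : ∀ τ, 0 ≤ p τ)
    (ρ : Equiv.Perm (Fin n)) (k : Fin n) : 0 ≤ mismatch p ρ k :=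
  Finset.sum_nonneg fun τ _ => mul_nonneg (hp τ) (by split_ifs <;> norm_num)

lemma mismatch_le_add {n : ℕ} {p : Equiv.Perm (Fin n) → ℝ} (hp : ∀ τ, 0 ≤ p τ)
    (hp1 : ∑ τ, p τ = 1) (ρ t : Equiv.Perm (Fin n)) (k : Fin n) :
    mismatch p ρ k ≤ mismatch p (t * ρ) k + if t (ρ k) ≠ ρ k then 1 else 0 := by
  have : (if t (ρ k) ≠ ρ k then (1 : ℝ) else 0) =
      ∑ τ, p τ * (if t (ρ k) ≠ ρ k then (1 : ℝ) else 0) := by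
    rw [← Finset.sum_mul, hp1, one_mul]
  rw [this, mismatch, mismatch, ← Finset.sum_add_distrib]
  refine Finset.sum_le_sum fun τ _ => ?_
  rw [← mul_add]
  refine mul_le_mul_of_nonneg_left ?_ (hp τ)
  by_cases h1 : t (ρ k) = ρ k
  · simp [h1]
  · simp only [ne_eq, h1, not_false_eq_true, if_true]
    split_ifs <;> norm_num

lemma mismatch_le_one {n : ℕ} {p : Equiv.Perm (Fin n) → ℝ} (hp : ∀ τ, 0 ≤ p τ)
    (hp1 : ∑ τ, p τ = 1) (ρ : Equiv.Perm (Fin n)) (k : Fin n) : mismatch p ρ k ≤ 1 := by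
  rw [← hp1]
  refine Finset.sum_le_sum fun τ _ => mul_le_of_le_one_right (hp τ) ?_
  split_ifs <;> norm_num

lemma sumMulLog_add_log_card_subgroup_nonneg {n : ℕ} {G : Subgroup (Equiv.Perm (Fin n))}
    {ν : Equiv.Perm (Fin n) → ℝ} (hν : IsProbOn ν (G : Set (Equiv.Perm (Fin n)))) :
    0 ≤ sumMulLog ν + Real.log (Nat.card G) := by
  have h := sumMulLog_add_log_card_nonneg (O := Finset.univ.filter (· ∈ G)) (α := ν)
    (by simpa using hν)
  have hcard : Nat.card G = (Finset.univ.filter (· ∈ G)).card := by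
    rw [Nat.card_eq_fintype_card, Fintype.card_subtype]
  rwa [hcard]

lemma mismatch_sum {n : ℕ} (q : Fin n → ℝ) (P : Fin n → Equiv.Perm (Fin n) → ℝ)
    (ρ : Equiv.Perm (Fin n)) (k : Fin n) :
    mismatch (fun τ => ∑ j, q j * P j τ) ρ k = ∑ j, q j * mismatch (P j) ρ k := by
  simp only [mismatch, Finset.mul_sum, Finset.sum_mul]
  rw [Finset.sum_comm]
  exact Finset.sum_congr rfl fun j _ => Finset.sum_congr rfl fun τ _ => by ring

lemma isPlan_glue {X ι : Type*} [Fintype X] [Fintype ι] {ν₁ ν₂ : X → ℝ} (f : X → ι)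
    (h₁ : ∀ x, 0 ≤ ν₁ x) (h₂ : ∀ x, 0 ≤ ν₂ x) {q : ι → ι → ℝ}
    (hq : IsPlan q (pushDensity ν₁ f) (pushDensity ν₂ f)) {P : ι → ι → X → X → ℝ}
    (hP0 : ∀ i j x y, 0 ≤ P i j x y) (hP1 : ∀ i j x, ∑ y, P i j x y = 1)
    (hP : ∀ i j, 0 < pushDensity ν₁ f i → 0 < pushDensity ν₂ f j →
      IsPlan (P i j) (condDensity ν₁ f i) (condDensity ν₂ f j)) :
    IsPlan (fun x y => ∑ j, q (f x) j * P (f x) j x y) ν₁ ν₂ := by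
  refine ⟨fun x y => Finset.sum_nonneg fun j _ => mul_nonneg (hq.1 _ _) (hP0 _ _ _ _),
    fun x => ?_, fun y => ?_⟩
  · rw [Finset.sum_comm]
    simp only [← Finset.mul_sum, hP1, mul_one, hq.2.1]
  · rw [sum_mul_eq_sum_pushDensity h₁ f fun i x => ∑ j, q i j * P i j x y]
    have h : ∀ i, pushDensity ν₁ f i * ∑ x, condDensity ν₁ f i x * ∑ j, q i j * P i j x y =
        ∑ j, pushDensity ν₁ f i * q i j * condDensity ν₂ f j y := by
      intro i
      simp only [Finset.mul_sum]
      rw [Finset.sum_comm]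
      refine Finset.sum_congr rfl fun j _ => ?_
      have h' : ∑ x, pushDensity ν₁ f i * (condDensity ν₁ f i x * (q i j * P i j x y)) =
          pushDensity ν₁ f i * q i j * ∑ x, condDensity ν₁ f i x * P i j x y := by
        rw [Finset.mul_sum]
        exact Finset.sum_congr rfl fun x _ => by ring
      rw [h']
      rcases (pushDensity_nonneg h₁ f i).eq_or_lt with hi | hi
      · simp [← hi]
      rcases (pushDensity_nonneg h₂ f j).eq_or_lt with hj | hj
      · rw [hq.eq_zero_of_eq_zero (pushDensity_nonneg h₁ f) hi hj.symm]
        simp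
      · rw [(hP i j hi hj).2.2]
    rw [Finset.sum_congr rfl fun i _ => h i, Finset.sum_comm]
    simp only [← Finset.sum_mul, hq.2.2, pushDensity_mul_condDensity h₂]
    simp

lemma hasShiftedPlan_of_pointStabilizer {n ℓ : ℕ} {G : Subgroup (Equiv.Perm (Fin n))}
    (hG : IsLLocal ℓ G) {u v : ℝ} (hu : 1 < u) (hv : 1 < v) (huv : u + v = u * v) {a : Fin n}
    (hK : ShiftedTransport (2 * ((ℓ : ℝ) - 1) ^ 2 + 2) u v (pointStabilizer G a))
    {ν₁ ν₂ : Equiv.Perm (Fin n) → ℝ}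
    (h₁ : IsProbOn ν₁ (G : Set (Equiv.Perm (Fin n))))
    (h₂ : IsProbOn ν₂ (G : Set (Equiv.Perm (Fin n)))) {B : ℝ} (hB : 0 ≤ B) :
    HasShiftedPlan ν₁ ν₂ (Pi.single a B)
      (entropyBound (2 * ((ℓ : ℝ) - 1) ^ 2 + 2) u v G ν₁ ν₂) := by
  set c : ℝ := 2 * ((ℓ : ℝ) - 1) ^ 2 + 2 with hc
  set f : Equiv.Perm (Fin n) → Fin n := fun σ => σ a with hf
  set α := pushDensity ν₁ f with hα
  set β := pushDensity ν₂ f with hβ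
  set K := pointStabilizer G a with hKdef
  have hα0 : ∀ i, 0 ≤ α i := pushDensity_nonneg h₁.1 f
  have hβ0 : ∀ i, 0 ≤ β i := pushDensity_nonneg h₂.1 f
  have hfO : ∀ σ ∈ (G : Set (Equiv.Perm (Fin n))), f σ ∈ (orbitFinset G a : Set (Fin n)) :=
    fun σ hσ => by
      simp only [orbitFinset, SetLike.mem_coe, Finset.mem_filter, Finset.mem_univ, true_and]
      exact ⟨σ, hσ, rfl⟩
  have hαO : IsProbOn α (orbitFinset G a : Set (Fin n)) := isProbOn_pushDensity f h₁ hfO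
  have hβO : IsProbOn β (orbitFinset G a : Set (Fin n)) := isProbOn_pushDensity f h₂ hfO
  obtain ⟨q, hq, hqc⟩ := exists_plan_sq_diag_le hu hv huv hαO hβO
  obtain ⟨t, ht1, ht⟩ := hG.exists_transfer
  have htij : ∀ i j, 0 < α i → 0 < β j →
      t i j ∈ G ∧ t i j i = j ∧ (i ≠ j → degree (t i j) ≤ ℓ) := by
    intro i j hi hj
    obtain ⟨σ, hσ, hσi⟩ := exists_of_pushDensity_pos f h₁ hi
    obtain ⟨τ, hτ, hτj⟩ := exists_of_pushDensity_pos f h₂ hj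
    rcases eq_or_ne i j with rfl | hij
    · rw [ht1]
      exact ⟨G.one_mem, rfl, fun h => absurd rfl h⟩
    · obtain ⟨h1, h2, h3⟩ := ht i j hij
        ⟨τ * σ⁻¹, G.mul_mem hτ (G.inv_mem hσ), by rw [← hσi, ← hτj]; simp [hf]⟩
      exact ⟨h1, h2, fun _ => h3⟩
  set b : Fin n → Fin n → ℝ := fun i k =>
    ∑ j, q i j * (if t i j k ≠ k ∧ k ≠ i then (1 : ℝ) else 0) with hb
  have hb0 : ∀ i k, 0 ≤ b i k := fun i k => Finset.sum_nonneg fun j _ =>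
    mul_nonneg (hq.1 i j) (by split_ifs <;> norm_num)
  have hplan : ∀ i j, ∃ P : Equiv.Perm (Fin n) → Equiv.Perm (Fin n) → ℝ,
      ((∀ σ τ, 0 ≤ P σ τ) ∧ ∀ σ, ∑ τ, P σ τ = 1) ∧ (0 < α i → 0 < β j →
        IsPlan P (condDensity ν₁ f i) (condDensity ν₂ f j) ∧
        ∑ σ, condDensity ν₁ f i σ * ∑ k, (mismatch (P σ) (t i j * σ) k + b i (σ k)) ^ 2 ≤
          2 * (∑ k, b i k) ^ 2 +
            entropyBound c u v K (condDensity ν₁ f i) (condDensity ν₂ f j)) := by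
    intro i j
    by_cases hij : 0 < α i ∧ 0 < β j
    · obtain ⟨hi, hj⟩ := hij
      obtain ⟨g, hg, hgi⟩ := exists_of_pushDensity_pos f h₁ hi
      obtain ⟨htG, hti, -⟩ := htij i j hi hj
      have hcoset : ∀ (h σ : Equiv.Perm (Fin n)), h ∈ G → σ ∈ G → σ a = h a → h⁻¹ * σ ∈ K := by
        intro h σ hh hσ heq
        refine mem_pointStabilizer.2 ⟨G.mul_mem (G.inv_mem hh) hσ, ?_⟩
        rw [Equiv.Perm.mul_apply, heq]
        simp
      have hc₁ : IsProbOn (condDensity ν₁ f i) {σ | g⁻¹ * σ ∈ K} := by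
        obtain ⟨p1, p2, p3⟩ := isProbOn_condDensity f h₁ hi
        exact ⟨p1, fun σ hσ => p2 σ fun h => hσ (hcoset g σ hg h.1 (h.2.trans hgi.symm)), p3⟩
      have hc₂ : IsProbOn (condDensity ν₂ f j) {τ | (t i j * g)⁻¹ * τ ∈ K} := by
        obtain ⟨p1, p2, p3⟩ := isProbOn_condDensity f h₂ hj
        refine ⟨p1, fun σ hσ => p2 σ fun h => hσ (hcoset (t i j * g) σ (G.mul_mem htG hg) h.1 ?_),
          p3⟩
        have : g a = i := hgi
        rw [Equiv.Perm.mul_apply, this, hti]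
        exact h.2
      obtain ⟨P, hP, hPc⟩ := hK.exists_plan_coset hc₁ hc₂ (hb0 i)
      exact ⟨P, ⟨hP.1, hP.2.1⟩, fun _ _ => ⟨hP, hPc⟩⟩
    · obtain ⟨_, ⟨p1, p2, -⟩, -⟩ := exists_isPlan_self ν₁
      exact ⟨_, ⟨p1, p2⟩, fun hi hj => absurd ⟨hi, hj⟩ hij⟩
  choose P hP hPij using hplan
  refine ⟨fun σ τ => ∑ j, q (f σ) j * P (f σ) j σ τ,
    isPlan_glue f h₁.1 h₂.1 hq (fun i j => (hP i j).1) (fun i j => (hP i j).2)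
      fun i j hi hj => (hPij i j hi hj).1, ?_⟩
  have hpt : ∀ σ, ν₁ σ * ∑ k, (mismatch (fun τ => ∑ j, q (f σ) j * P (f σ) j σ τ) σ k +
      Pi.single (M := fun _ => ℝ) a B k) ^ 2 ≤ ν₁ σ * ((1 - q (f σ) (f σ) + B) ^ 2 +
        ∑ j, q (f σ) j *
          ∑ k, (mismatch (P (f σ) j σ) (t (f σ) j * σ) k + b (f σ) (σ k)) ^ 2) := by
    intro σ
    rcases (h₁.1 σ).eq_or_lt with h0 | h0
    · simp [← h0]
    refine mul_le_mul_of_nonneg_left ?_ h0.le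
    set i := f σ with hi
    have hαi : 0 < α i := h0.trans_le (le_pushDensity h₁.1 f σ)
    have hz0 : ∀ k, 0 ≤ mismatch (fun τ => ∑ j, q i j * P i j σ τ) σ k := fun k =>
      mismatch_nonneg (fun τ => Finset.sum_nonneg fun j _ =>
        mul_nonneg (hq.1 i j) ((hP i j).1 σ τ)) _ _
    have hza : mismatch (fun τ => ∑ j, q i j * P i j σ τ) σ a ≤ 1 - q i i := by
      have hle : ∀ j, q i j * mismatch (P i j σ) σ a ≤ q i j - if i = j then q i j else 0 := by
        intro j
        split_ifs with hij
        · rw [sub_self]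
          rcases (hβ0 j).eq_or_lt with hj | hj
          · rw [hq.eq_zero_of_eq_zero hα0 hαi hj.symm, zero_mul]
          refine (mul_eq_zero_of_right _ (Finset.sum_eq_zero fun τ _ => ?_)).le
          split_ifs with hτ
          · have hcσ : 0 < condDensity ν₁ f i σ := by
              rw [condDensity, if_pos rfl]
              exact div_pos h0 hαi
            rw [(hPij i j hαi hj).1.eq_zero_of_eq_zero (condDensity_nonneg h₁.1 f i) hcσ, zero_mul]
            rw [condDensity, if_neg]
            rintro rfl
            exact hτ hij
          · rw [mul_zero]
        · rw [sub_zero]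
          exact mul_le_of_le_one_right (hq.1 i j)
            (mismatch_le_one ((hP i j).1 σ) ((hP i j).2 σ) _ _)
      rw [mismatch_sum]
      refine (Finset.sum_le_sum fun j _ => hle j).trans_eq ?_
      rw [Finset.sum_sub_distrib, hq.2.1]
      simp
    have hzk : ∀ k, k ≠ a → mismatch (fun τ => ∑ j, q i j * P i j σ τ) σ k ≤
        ∑ j, q i j * (mismatch (P i j σ) (t i j * σ) k + b i (σ k)) := by
      intro k hk
      have hσk : σ k ≠ i := fun h => hk (σ.injective h)
      have hbk : b i (σ k) = ∑ j, q i j * (if t i j (σ k) ≠ σ k then (1 : ℝ) else 0) := by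
        simp only [hb, hσk, ne_eq, not_false_eq_true, and_true]
      rw [mismatch_sum]
      calc _ ≤ ∑ j, q i j * (mismatch (P i j σ) (t i j * σ) k +
            if t i j (σ k) ≠ σ k then (1 : ℝ) else 0) :=
            Finset.sum_le_sum fun j _ => mul_le_mul_of_nonneg_left
              (mismatch_le_add ((hP i j).1 σ) ((hP i j).2 σ) _ _ _) (hq.1 i j)
        _ = _ := by
            simp only [mul_add, Finset.sum_add_distrib]
            rw [← Finset.sum_mul, hq.2.1, one_mul, hbk]
    have hterm : ∀ k, (mismatch (fun τ => ∑ j, q i j * P i j σ τ) σ k +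
        Pi.single (M := fun _ => ℝ) a B k) ^ 2 ≤ (if k = a then (1 - q i i + B) ^ 2 else 0) +
        ∑ j, q i j * (mismatch (P i j σ) (t i j * σ) k + b i (σ k)) ^ 2 := by
      intro k
      have hsum0 : 0 ≤ ∑ j, q i j * (mismatch (P i j σ) (t i j * σ) k + b i (σ k)) ^ 2 :=
        Finset.sum_nonneg fun j _ => mul_nonneg (hq.1 i j) (sq_nonneg _)
      by_cases hk : k = a
      · subst hk
        rw [if_pos rfl, Pi.single_eq_same]
        have := pow_le_pow_left₀ (add_nonneg (hz0 k) hB) (add_le_add_left hza B) 2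
        linarith
      · rw [if_neg hk, Pi.single_eq_of_ne hk, add_zero, zero_add]
        exact (pow_le_pow_left₀ (hz0 k) (hzk k hk) 2).trans
          (Real.pow_arith_mean_le_arith_mean_pow_of_even _ _ _ (fun j _ => hq.1 i j)
            (hq.2.1 i) even_two)
    refine (Finset.sum_le_sum fun k _ => hterm k).trans_eq ?_
    rw [Finset.sum_add_distrib, Finset.sum_ite_eq', if_pos (Finset.mem_univ a), Finset.sum_comm]
    simp only [Finset.mul_sum]
  have hbsum : ∀ i, 0 < α i → ∑ k, b i k ≤ ((ℓ : ℝ) - 1) * (1 - q i i) := by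
    intro i hi
    rw [hb, Finset.sum_comm]
    simp only [← Finset.mul_sum]
    have hle : ∀ j, q i j * ∑ k, (if t i j k ≠ k ∧ k ≠ i then (1 : ℝ) else 0) ≤
        (q i j - if i = j then q i j else 0) * ((ℓ : ℝ) - 1) := by
      intro j
      split_ifs with hij
      · subst hij
        simp [ht1]
      · rw [sub_zero]
        rcases (hβ0 j).eq_or_lt with hj | hj
        · rw [hq.eq_zero_of_eq_zero hα0 hi hj.symm]
          simp
        · obtain ⟨-, hti, hdeg⟩ := htij i j hi hj
          exact mul_le_mul_of_nonneg_left
            (sum_moved_le (by rw [hti]; exact fun h => hij h.symm) (hdeg hij)) (hq.1 i j)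
    refine (Finset.sum_le_sum fun j _ => hle j).trans_eq ?_
    rw [← Finset.sum_mul, Finset.sum_sub_distrib, hq.2.1]
    simp [mul_comm]
  have hfib : ∀ i, α i * ∑ σ, condDensity ν₁ f i σ * ((1 - q i i + B) ^ 2 +
      ∑ j, q i j * ∑ k, (mismatch (P i j σ) (t i j * σ) k + b i (σ k)) ^ 2) ≤
      α i * (2 * B ^ 2) + c * (α i * (1 - q i i) ^ 2) + ∑ j, α i * q i j *
        entropyBound c u v K (condDensity ν₁ f i) (condDensity ν₂ f j) := by
    intro i
    rcases (hα0 i).eq_or_lt with hi | hi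
    · simp [← hi]
    have hj : ∀ j, q i j * ∑ σ, condDensity ν₁ f i σ *
        ∑ k, (mismatch (P i j σ) (t i j * σ) k + b i (σ k)) ^ 2 ≤
        q i j * (2 * (((ℓ : ℝ) - 1) * (1 - q i i)) ^ 2 +
          entropyBound c u v K (condDensity ν₁ f i) (condDensity ν₂ f j)) := by
      intro j
      rcases (hβ0 j).eq_or_lt with hj | hj
      · rw [hq.eq_zero_of_eq_zero hα0 hi hj.symm]
        simp
      · refine mul_le_mul_of_nonneg_left ((hPij i j hi hj).2.trans ?_) (hq.1 i j)
        have := pow_le_pow_left₀ (Finset.sum_nonneg fun k _ => hb0 i k) (hbsum i hi) 2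
        linarith
    have hsum : ∑ σ, condDensity ν₁ f i σ * ((1 - q i i + B) ^ 2 +
        ∑ j, q i j * ∑ k, (mismatch (P i j σ) (t i j * σ) k + b i (σ k)) ^ 2) =
        (1 - q i i + B) ^ 2 + ∑ j, q i j * ∑ σ, condDensity ν₁ f i σ *
          ∑ k, (mismatch (P i j σ) (t i j * σ) k + b i (σ k)) ^ 2 := by
      simp only [mul_add (condDensity _ _ _ _), Finset.sum_add_distrib]
      rw [← Finset.sum_mul, sum_condDensity h₁.1 f hi, one_mul]
      congr 1
      simp only [Finset.mul_sum (s := (Finset.univ : Finset (Equiv.Perm (Fin n)))),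
        Finset.mul_sum (s := (Finset.univ : Finset (Fin n)))]
      rw [Finset.sum_comm]
      exact Finset.sum_congr rfl fun j _ => Finset.sum_congr rfl fun σ _ =>
        Finset.sum_congr rfl fun k _ => by ring
    have hj' := Finset.sum_le_sum fun j (_ : j ∈ Finset.univ) => hj j
    simp only [mul_add (q i _), Finset.sum_add_distrib] at hj'
    rw [← Finset.sum_mul, hq.2.1, one_mul] at hj'
    rw [hsum]
    simp only [mul_assoc (α i)]
    rw [← Finset.mul_sum, ← mul_left_comm (α i), ← mul_add, ← mul_add]
    refine mul_le_mul_of_nonneg_left ?_ hi.le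
    nlinarith [sq_nonneg (1 - q i i - B)]
  have hent : ∑ i, ∑ j, α i * q i j *
      entropyBound c u v K (condDensity ν₁ f i) (condDensity ν₂ f j) =
      2 * c * (u * (∑ i, α i * sumMulLog (condDensity ν₁ f i) + Real.log (Nat.card K)) +
        v * (∑ j, β j * sumMulLog (condDensity ν₂ f j) + Real.log (Nat.card K))) := by
    have hrow : ∀ g : Fin n → ℝ, ∑ i, ∑ j, α i * q i j * g i = ∑ i, α i * g i := by
      intro g
      refine Finset.sum_congr rfl fun i _ => ?_
      rw [← Finset.sum_mul, ← Finset.mul_sum, hq.2.1, mul_one]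
    have hcol : ∀ g : Fin n → ℝ, ∑ i, ∑ j, α i * q i j * g j = ∑ j, β j * g j := by
      intro g
      rw [Finset.sum_comm]
      refine Finset.sum_congr rfl fun j _ => ?_
      rw [← Finset.sum_mul, hq.2.2]
    have hsplit : ∀ i j, α i * q i j *
        entropyBound c u v K (condDensity ν₁ f i) (condDensity ν₂ f j) =
        α i * q i j * (2 * c * u * (sumMulLog (condDensity ν₁ f i) + Real.log (Nat.card K))) +
        α i * q i j * (2 * c * v * (sumMulLog (condDensity ν₂ f j) + Real.log (Nat.card K))) := by
      intro i j
      unfold entropyBound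
      ring
    simp only [hsplit, Finset.sum_add_distrib]
    rw [hrow fun i => 2 * c * u * (sumMulLog (condDensity ν₁ f i) + Real.log (Nat.card K)),
      hcol fun j => 2 * c * v * (sumMulLog (condDensity ν₂ f j) + Real.log (Nat.card K))]
    have hlin : ∀ (γ s : Fin n → ℝ) (w : ℝ), ∑ i, γ i = 1 →
        ∑ i, γ i * (2 * c * w * (s i + Real.log (Nat.card K))) =
        2 * c * (w * (∑ i, γ i * s i + Real.log (Nat.card K))) := by
      intro γ s w hγ
      have : ∀ i, γ i * (2 * c * w * (s i + Real.log (Nat.card K))) =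
          2 * c * w * (γ i * s i) + γ i * (2 * c * w * Real.log (Nat.card K)) := fun i => by ring
      simp only [this, Finset.sum_add_distrib]
      rw [← Finset.sum_mul, hγ, ← Finset.mul_sum]
      ring
    rw [hlin α _ u hαO.2.2, hlin β _ v hβO.2.2]
    ring
  refine (Finset.sum_le_sum fun σ _ => hpt σ).trans ?_
  rw [sum_mul_eq_sum_pushDensity h₁.1 f fun i σ => (1 - q i i + B) ^ 2 +
    ∑ j, q i j * ∑ k, (mismatch (P i j σ) (t i j * σ) k + b i (σ k)) ^ 2]
  refine (Finset.sum_le_sum fun i _ => hfib i).trans ?_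
  rw [Finset.sum_add_distrib, Finset.sum_add_distrib, ← Finset.sum_mul, ← Finset.mul_sum,
    hαO.2.2, hent, entropyBound, log_card_eq_add G a, sumMulLog_eq_add_sum h₁.1 f,
    sumMulLog_eq_add_sum h₂.1 f, Finset.sum_pi_single', if_pos (Finset.mem_univ a)]
  have hc0 : 0 ≤ c := by positivity
  nlinarith [mul_le_mul_of_nonneg_left hqc hc0]

lemma shiftedTransport_of_isLLocal {n ℓ : ℕ} (hn : 0 < n) {u v : ℝ} (hu : 1 < u) (hv : 1 < v)
    (huv : u + v = u * v) (G : Subgroup (Equiv.Perm (Fin n))) (hG : IsLLocal ℓ G) :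
    ShiftedTransport (2 * ((ℓ : ℝ) - 1) ^ 2 + 2) u v G := by
  induction G using WellFoundedLT.induction with
  | _ G ih =>
  intro ν₁ ν₂ h₁ h₂ b hb
  refine hasShiftedPlan_of_single hn h₁.1 (fun a B hB => ?_) hb
  have hstep : ∀ a', (∃ σ ∈ G, σ a' ≠ a') → ∀ B', 0 ≤ B' →
      HasShiftedPlan ν₁ ν₂ (Pi.single a' B')
        (entropyBound (2 * ((ℓ : ℝ) - 1) ^ 2 + 2) u v G ν₁ ν₂) := by
    rintro a' ⟨σ, hσ, hσa⟩ B' hB'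
    refine hasShiftedPlan_of_pointStabilizer hG hu hv huv (ih _ ?_ (hG.pointStabilizer a')) h₁ h₂ hB'
    exact lt_of_le_of_ne (fun τ hτ => (mem_pointStabilizer.1 hτ).1)
      fun h => hσa (mem_pointStabilizer.1 (h ▸ hσ)).2
  by_cases ha : ∃ σ ∈ G, σ a ≠ a
  · exact hstep a ha B hB
  push Not at ha
  have hzero : HasShiftedPlan ν₁ ν₂ 0
      (entropyBound (2 * ((ℓ : ℝ) - 1) ^ 2 + 2) u v G ν₁ ν₂) := by
    by_cases ha' : ∃ a', ∃ σ ∈ G, σ a' ≠ a'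
    · obtain ⟨a', h⟩ := ha'
      simpa using hstep a' h 0 le_rfl
    push Not at ha'
    have hdirac : ∀ ν : Equiv.Perm (Fin n) → ℝ, IsProbOn ν (G : Set (Equiv.Perm (Fin n))) →
        ∀ σ, ν σ = if σ = 1 then 1 else 0 := by
      intro ν hν
      have hne : ∀ σ, σ ≠ 1 → ν σ = 0 := fun σ hσ =>
        hν.2.1 σ fun h => hσ (Equiv.ext fun k => ha' k σ h)
      intro σ
      split_ifs with hσ
      · rw [hσ, ← hν.2.2, Finset.sum_eq_single_of_mem 1 (Finset.mem_univ _) fun τ _ h => hne τ h]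
      · exact hne σ hσ
    have heq : ν₁ = ν₂ := funext fun σ => by rw [hdirac ν₁ h₁, hdirac ν₂ h₂]
    subst heq
    obtain ⟨p, hp, hpd⟩ := exists_isPlan_self ν₁
    refine ⟨p, hp, ?_⟩
    have hS := sumMulLog_add_log_card_subgroup_nonneg h₁
    have h0 : 0 ≤ entropyBound (2 * ((ℓ : ℝ) - 1) ^ 2 + 2) u v G ν₁ ν₁ := by
      unfold entropyBound
      positivity
    have hm : ∀ σ k, mismatch (p σ) σ k = 0 :=
      fun σ k => Finset.sum_eq_zero fun τ _ => by
        by_cases h : σ = τ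
        · simp [h]
        · rw [hpd σ τ h, zero_mul]
    simpa [hm] using h0
  obtain ⟨p, hp, hpc⟩ := hzero
  refine ⟨p, hp, ?_⟩
  have hterm : ∀ σ, ν₁ σ * ∑ k, (mismatch (p σ) σ k + Pi.single (M := fun _ => ℝ) a B k) ^ 2 =
      ν₁ σ * ∑ k, (mismatch (p σ) σ k + (0 : Fin n → ℝ) k) ^ 2 + ν₁ σ * B ^ 2 := by
    intro σ
    rcases (h₁.1 σ).eq_or_lt with h0 | h0
    · simp [← h0]
    have hσ : σ ∈ G := by
      by_contra h
      exact h0.ne' (h₁.2.1 σ h)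
    have hma : mismatch (p σ) σ a = 0 := by
      refine Finset.sum_eq_zero fun τ _ => ?_
      by_cases hτ : τ ∈ G
      · rw [ha σ hσ, ha τ hτ]
        simp
      · rw [hp.eq_zero_of_eq_zero h₁.1 h0 (h₂.2.1 τ hτ), zero_mul]
    rw [← mul_add]
    congr 1
    have : B ^ 2 = ∑ k, if k = a then B ^ 2 else 0 := by simp
    rw [this, ← Finset.sum_add_distrib]
    refine Finset.sum_congr rfl fun k _ => ?_
    by_cases hk : k = a
    · subst hk
      simp [hma]
    · simp [hk]
  rw [Finset.sum_congr rfl fun σ _ => hterm σ, Finset.sum_add_distrib, ← Finset.sum_mul, h₁.2.2,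
    Finset.sum_pi_single', if_pos (Finset.mem_univ a)]
  simp only [Pi.zero_apply, Finset.sum_const_zero] at hpc ⊢
  nlinarith [sq_nonneg B]

lemma le_mul_sq_sqrt_add {T D A B : ℝ} (hD : 0 ≤ D) (hA : 0 ≤ A) (hB : 0 ≤ B)
    (h : ∀ u v : ℝ, 1 < u → 1 < v → u + v = u * v → T ≤ D * (u * A + v * B)) :
    T ≤ D * (√A + √B) ^ 2 := by
  set x := √A with hx
  set y := √B with hy
  have hx0 : 0 ≤ x := Real.sqrt_nonneg _
  have hy0 : 0 ≤ y := Real.sqrt_nonneg _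
  have hA' : A = x ^ 2 := (Real.sq_sqrt hA).symm
  have hB' : B = y ^ 2 := (Real.sq_sqrt hB).symm
  have key : ∀ δ : ℝ, 0 < δ → T ≤ D * ((x + y + 2 * δ) * (x + y)) := by
    intro δ hδ
    have hxδ : 0 < x + δ := by linarith
    have hyδ : 0 < y + δ := by linarith
    refine (h ((x + y + 2 * δ) / (x + δ)) ((x + y + 2 * δ) / (y + δ))
      ((one_lt_div hxδ).2 (by linarith)) ((one_lt_div hyδ).2 (by linarith))
      (by field_simp; ring)).trans (mul_le_mul_of_nonneg_left ?_ hD)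
    have hpart : ∀ z : ℝ, 0 ≤ z →
        (x + y + 2 * δ) / (z + δ) * z ^ 2 ≤ (x + y + 2 * δ) * z := by
      intro z hz
      have hzδ : 0 < z + δ := by linarith
      rw [div_mul_eq_mul_div, div_le_iff₀ hzδ, mul_assoc]
      exact mul_le_mul_of_nonneg_left (by nlinarith) (by linarith)
    rw [hA', hB', mul_add]
    exact add_le_add (hpart x hx0) (hpart y hy0)
  refine le_of_forall_pos_le_add fun ε hε => ?_
  have hpos : 0 < 2 * D * (x + y) + 1 := by positivity
  have h1 := key (ε / (2 * D * (x + y) + 1)) (div_pos hε hpos)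
  have h2 : 2 * D * (x + y) * (ε / (2 * D * (x + y) + 1)) ≤ ε := by
    rw [mul_div_assoc', div_le_iff₀ hpos]
    nlinarith
  linarith

lemma relEnt_unif {n : ℕ} {G : Subgroup (Equiv.Perm (Fin n))} {ν : Equiv.Perm (Fin n) → ℝ}
    (hν : IsProbOn ν (G : Set (Equiv.Perm (Fin n)))) :
    relEnt ν (unif G) = ENNReal.ofReal (sumMulLog ν + Real.log (Nat.card G)) := by
  have hcard : (Nat.card G : ℝ) ≠ 0 := by exact_mod_cast Nat.card_pos.ne'
  have hac : ∀ σ, unif G σ = 0 → ν σ = 0 := by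
    refine fun σ hσ => hν.2.1 σ fun hσG => ?_
    rw [unif, if_pos (SetLike.mem_coe.1 hσG)] at hσ
    exact inv_ne_zero hcard hσ
  rw [relEnt, if_pos hac]
  congr 1
  have hterm : ∀ σ, ν σ * Real.log (ν σ / unif G σ) =
      ν σ * Real.log (ν σ) + ν σ * Real.log (Nat.card G) := by
    intro σ
    rcases eq_or_ne (ν σ) 0 with h0 | h0
    · simp [h0]
    have hσ : σ ∈ G := by
      by_contra h
      exact h0 (hν.2.1 σ h)
    rw [unif, if_pos hσ, div_inv_eq_mul, Real.log_mul h0 hcard]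
    ring
  rw [Finset.sum_congr rfl fun σ _ => hterm σ, Finset.sum_add_distrib, ← Finset.sum_mul, hν.2.2,
    one_mul, sumMulLog]

lemma parenT2_le_of_hasShiftedPlan {n : ℕ} {ν₁ ν₂ : Equiv.Perm (Fin n) → ℝ} {C : ℝ}
    (hν : ∀ σ, 0 ≤ ν₁ σ) (h : HasShiftedPlan ν₁ ν₂ 0 C) : parenT2 ν₁ ν₂ ≤ C := by
  obtain ⟨p, ⟨hp0, hp1, hp2⟩, hpc⟩ := h
  have hcost : ∑ σ, ν₁ σ * ∑ k, mismatch (p σ) σ k ^ 2 ≤ C := by simpa using hpc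
  unfold parenT2
  refine le_trans (csInf_le ?_ ⟨p, hp0, hp1, hp2, rfl⟩) hcost
  refine ⟨0, ?_⟩
  rintro w ⟨p', -, -, -, rfl⟩
  exact Finset.sum_nonneg fun σ _ => mul_nonneg (hν σ)
    (Finset.sum_nonneg fun i _ => sq_nonneg _)

/-- Transport-entropy inequality for the weak cost `T⌒₂` and the uniform measure on
an `ℓ`-local group, with `c² = 2(ℓ-1)² + 2`. -/
theorem stmt7 {n ℓ : ℕ} (hn : 2 ≤ n) (hℓ : 2 ≤ ℓ) (hℓn : ℓ ≤ n)
    (G : Subgroup (Equiv.Perm (Fin n))) (hG : IsLLocal ℓ G)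
    (ν₁ ν₂ : Equiv.Perm (Fin n) → ℝ)
    (hν₁ : IsProbOn ν₁ (G : Set (Equiv.Perm (Fin n))))
    (hν₂ : IsProbOn ν₂ (G : Set (Equiv.Perm (Fin n)))) :
    ENNReal.ofReal (parenT2 ν₁ ν₂) ≤
      ENNReal.ofReal (2 * (2 * ((ℓ : ℝ) - 1) ^ 2 + 2)) *
        (relEnt ν₁ (unif G) ^ ((1 : ℝ) / 2) + relEnt ν₂ (unif G) ^ ((1 : ℝ) / 2)) ^ 2 := by
  have hA := sumMulLog_add_log_card_subgroup_nonneg hν₁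
  have hB := sumMulLog_add_log_card_subgroup_nonneg hν₂
  have hc : 0 ≤ 2 * (2 * ((ℓ : ℝ) - 1) ^ 2 + 2) := by positivity
  have hT := le_mul_sq_sqrt_add hc hA hB fun u v hu hv huv =>
    parenT2_le_of_hasShiftedPlan hν₁.1
      (shiftedTransport_of_isLLocal (by omega) hu hv huv G hG ν₁ ν₂ hν₁ hν₂ 0 fun _ => le_rfl)
  rw [relEnt_unif hν₁, relEnt_unif hν₂, ENNReal.ofReal_rpow_of_nonneg hA (by norm_num),
    ENNReal.ofReal_rpow_of_nonneg hB (by norm_num), ← Real.sqrt_eq_rpow, ← Real.sqrt_eq_rpow,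
    ← ENNReal.ofReal_add (Real.sqrt_nonneg _) (Real.sqrt_nonneg _),
    ← ENNReal.ofReal_pow (add_nonneg (Real.sqrt_nonneg _) (Real.sqrt_nonneg _)),
    ← ENNReal.ofReal_mul hc]
  exact ENNReal.ofReal_le_ofReal hT

end
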